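/- Let m, n, k_1, …, k_m be nonnegative integers with k_1 + ⋯ + k_m = n. Then [n; k_1, …, k_m]_q = Σ_{E} Σ_{(r_{u,v})} q^{Σ_{u=1}^{s} Σ_{v=2}^{m} f(r_{u,v})} · [n_1; 0, r_{1,2}, …, r_{1,m}]_q ⋯ [n_s; 0, r_{s,2}, …, r_{s,m}]_q, where the outer sum is over all k_1-element subsets E = {e_1 < ⋯ < e_{k_1}} of {1, …, n}; s = k_1 + 1; n_1 = e_1 − 1, n_i = e_i − e_{i−1} − 1 for 2 ≤ i ≤ k_1, and n_s = n − e_{k_1}; the inner sum is over all arrays of nonnegative integers (r_{u,v}) for u ∈ {1,…,s}, v ∈ {2,…,m} satisfying r_{u,2} + ⋯ + r_{u,m} = n_u for every u and r_{1,v} + ⋯ + r_{s,v} = k_v for every v ∈ {2,…,m}; and f(r_{u,v}) = r_{u,v} · ( k_1 − u + 1 + Σ_{i=u+1}^{s} Σ_{j=2}^{v−1} r_{i,j} ). -/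

import Mathlib

open Finset Polynomial

/-- Number of inversions of a sequence. -/
def invStat {n m : ℕ} (σ : Fin n → Fin m) : ℕ :=
  ((Finset.univ : Finset (Fin n × Fin n)).filter fun p => p.1 < p.2 ∧ σ p.2 < σ p.1).card

/-- The `q`-multinomial coefficient `[n; k_1, …, k_m]_q`, defined as the generating
polynomial `Σ_σ q^{inv σ}` over the set `S(n, m; k_1, …, k_m)` of sequences of length `n`
with entries in `{1, …, m}` (encoded as `Fin m`) having exactly `k_j` entries equal to
`j` for each `j`. -/
noncomputable def qMultinomial (n m : ℕ) (k : Fin m → ℕ) : Polynomial ℤ :=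
  ∑ σ ∈ (Finset.univ : Finset (Fin n → Fin m)).filter
      (fun σ => ∀ j, (Finset.univ.filter fun a => σ a = j).card = k j),
    X ^ invStat σ

/-- Given a `k₁`-element subset `E = {e_1 < ⋯ < e_{k₁}}` of `{1, …, n}`, the position
`epos n k₁ E hE i` is the 1-based value `e_i` for `1 ≤ i ≤ k₁`, with the conventions
`epos … 0 = 0` and `epos … i = n + 1` for `i > k₁`. -/
def epos (n k₁ : ℕ) (E : Finset (Fin n)) (hE : E.card = k₁) : ℕ → ℕ := fun i =>
  if hi : i = 0 then 0
  else if h : i ≤ k₁ then ((E.orderIsoOfFin hE ⟨i - 1, by omega⟩).1 : ℕ) + 1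
  else n + 1

/-- The block lengths `n_1 = e_1 − 1`, `n_i = e_i − e_{i−1} − 1` for `2 ≤ i ≤ k₁`, and
`n_s = n − e_{k₁}` (with `s = k₁ + 1`), 0-indexed by `u : Fin (k₁ + 1)`. -/
def blockLen (n k₁ : ℕ) (E : Finset (Fin n)) (hE : E.card = k₁) : Fin (k₁ + 1) → ℕ :=
  fun u => epos n k₁ E hE ((u : ℕ) + 1) - epos n k₁ E hE (u : ℕ) - 1

section Epos

variable (n k₁ : ℕ) (E : Finset (Fin n)) (hE : E.card = k₁)

theorem epos_zero : epos n k₁ E hE 0 = 0 := by simp [epos]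

theorem epos_last : epos n k₁ E hE (k₁ + 1) = n + 1 := by simp [epos]

theorem epos_succ (i : Fin k₁) : epos n k₁ E hE (i + 1) = (E.orderEmbOfFin hE i : ℕ) + 1 := by
  have h : (i : ℕ) + 1 ≤ k₁ := i.2
  simp [epos, h]

theorem epos_lt_succ {i : ℕ} (hi : i ≤ k₁) :
    epos n k₁ E hE i < epos n k₁ E hE (i + 1) := by
  rcases i with _ | i
  · rcases Nat.eq_zero_or_pos k₁ with h | h
    · subst h
      rw [epos_zero, epos_last]
      omega
    · have := epos_succ n k₁ E hE ⟨0, h⟩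
      rw [epos_zero]
      simp only at this
      omega
  · have h₁ := epos_succ n k₁ E hE ⟨i, hi⟩
    rcases Nat.lt_or_ge (i + 1) k₁ with h | h
    · have h₂ := epos_succ n k₁ E hE ⟨i + 1, h⟩
      have h₃ : E.orderEmbOfFin hE ⟨i, hi⟩ < E.orderEmbOfFin hE ⟨i + 1, h⟩ := by
        simp [Fin.lt_def]
      rw [Fin.lt_def] at h₃
      simp only at h₁ h₂
      omega
    · have h₄ : i + 1 = k₁ := le_antisymm hi h
      have h₂ := epos_last n k₁ E hE
      have h₃ := (E.orderEmbOfFin hE ⟨i, hi⟩).2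
      simp only at h₁
      rw [h₁, h₄, h₂]
      omega

theorem epos_mono {i j : ℕ} (hij : i ≤ j) (hj : j ≤ k₁ + 1) :
    epos n k₁ E hE i ≤ epos n k₁ E hE j := by
  induction j, hij using Nat.le_induction with
  | base => exact le_rfl
  | succ j _ ih => exact (ih (by omega)).trans (epos_lt_succ n k₁ E hE (by omega)).le

theorem epos_add_blockLen (u : Fin (k₁ + 1)) :
    epos n k₁ E hE u + blockLen n k₁ E hE u + 1 = epos n k₁ E hE (u + 1) := by
  have := epos_lt_succ n k₁ E hE (i := u) (by omega)
  unfold blockLen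
  omega

theorem add_sum_blockLen : k₁ + ∑ u, blockLen n k₁ E hE u = n := by
  have h : ∀ j ≤ k₁ + 1, epos n k₁ E hE j =
      j + ∑ u ∈ Finset.range j,
        (epos n k₁ E hE (u + 1) - epos n k₁ E hE u - 1) := by
    intro j
    induction j with
    | zero => simp [epos_zero]
    | succ j ih =>
      intro hj
      have := epos_lt_succ n k₁ E hE (i := j) (by omega)
      have := ih (by omega)
      rw [Finset.sum_range_succ]
      omega
  have h' := h (k₁ + 1) le_rfl
  rw [epos_last, Finset.sum_range] at h'
  unfold blockLen
  omega

/-- A `k₁`-element subset `E` splits `Fin n` into `E` and the `k₁ + 1` blocks between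
consecutive elements of `E`. -/
theorem exists_blockEquiv :
    ∃ P : Fin k₁ ⊕ (Σ u : Fin (k₁ + 1), Fin (blockLen n k₁ E hE u)) ≃ Fin n,
      (∀ i, P (.inl i) ∈ E) ∧ (∀ p, P (.inr p) ∉ E) ∧
      (∀ u x i, P (.inr ⟨u, x⟩) < P (.inl i) ↔ (u : ℕ) ≤ i) ∧
      (∀ u v x y, u < v → P (.inr ⟨u, x⟩) < P (.inr ⟨v, y⟩)) ∧
      (∀ u x y, P (.inr ⟨u, x⟩) < P (.inr ⟨u, y⟩) ↔ x < y) := by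
  have hlt (u : Fin (k₁ + 1)) (x : Fin (blockLen n k₁ E hE u)) :
      epos n k₁ E hE u + x + 1 < epos n k₁ E hE (u + 1) := by
    have := epos_add_blockLen n k₁ E hE u
    omega
  have hn (u : Fin (k₁ + 1)) : epos n k₁ E hE (u + 1) ≤ n + 1 := by
    rw [← epos_last n k₁ E hE]
    exact epos_mono n k₁ E hE (by omega) le_rfl
  let F : Fin k₁ ⊕ (Σ u : Fin (k₁ + 1), Fin (blockLen n k₁ E hE u)) → Fin n :=
    Sum.elim (E.orderEmbOfFin hE) fun p =>
      ⟨epos n k₁ E hE p.1 + p.2, by have := hlt p.1 p.2; have := hn p.1; omega⟩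
  have hF₁ (i) : (F (.inl i) : ℕ) + 1 = epos n k₁ E hE (i + 1) :=
    (epos_succ n k₁ E hE i).symm
  have hF₂ (u x) : (F (.inr ⟨u, x⟩) : ℕ) = epos n k₁ E hE u + x := rfl
  have h_le (u : Fin (k₁ + 1)) (x) (i : Fin k₁) (h : (u : ℕ) ≤ i) : F (.inr ⟨u, x⟩) < F (.inl i) := by
    have := epos_mono n k₁ E hE (i := u + 1) (j := i + 1) (by omega) (by omega)
    have := hlt u x
    have := hF₁ i
    have := hF₂ u x
    rw [Fin.lt_def]
    omega
  have h_gt (u : Fin (k₁ + 1)) (x) (i : Fin k₁) (h : (i : ℕ) < u) : F (.inl i) < F (.inr ⟨u, x⟩) := by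
    have := epos_mono n k₁ E hE (i := i + 1) (j := u) (by omega) (by omega)
    have := hF₁ i
    have := hF₂ u x
    rw [Fin.lt_def]
    omega
  have h_blocks (u v x y) (h : u < v) : F (.inr ⟨u, x⟩) < F (.inr ⟨v, y⟩) := by
    rw [Fin.lt_def] at h
    have := epos_mono n k₁ E hE (i := u + 1) (j := v) (by omega) (by omega)
    have := hlt u x
    have := hF₂ u x
    have := hF₂ v y
    rw [Fin.lt_def]
    omega
  have h_ne (p i) : F (.inr p) ≠ F (.inl i) := by
    rcases le_or_gt (p.1 : ℕ) i with h | h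
    · exact (h_le p.1 p.2 i h).ne
    · exact (h_gt p.1 p.2 i h).ne'
  have hinj : Function.Injective F := by
    rintro (i | ⟨u, x⟩) (j | ⟨v, y⟩) h
    · exact congrArg _ ((E.orderEmbOfFin hE).injective h)
    · exact (h_ne _ _ h.symm).elim
    · exact (h_ne _ _ h).elim
    · rcases lt_trichotomy u v with huv | rfl | huv
      · exact ((h_blocks u v x y huv).ne h).elim
      · have hxy : (x : ℕ) = y := by
          have := congrArg Fin.val h
          rw [hF₂, hF₂] at this
          omega
        rw [Fin.ext hxy]
      · exact ((h_blocks v u y x huv).ne' h).elim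
  have hbij : Function.Bijective F := by
    rw [Fintype.bijective_iff_injective_and_card]
    refine ⟨hinj, ?_⟩
    simpa using add_sum_blockLen n k₁ E hE
  refine ⟨Equiv.ofBijective F hbij, fun i => E.orderEmbOfFin_mem hE i, fun p hp => ?_,
    fun u x i => ⟨fun h => ?_, h_le u x i⟩, h_blocks, fun u x y => ?_⟩
  · have : F (.inr p) ∈ Set.range (E.orderEmbOfFin hE) := by
      rw [Finset.range_orderEmbOfFin]
      exact hp
    obtain ⟨i, hi⟩ := this
    exact h_ne p i hi.symm
  · by_contra! h'
    exact lt_asymm h (h_gt u x i h')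
  · simp only [Equiv.ofBijective_apply, Fin.lt_def, hF₂]
    omega

end Epos

theorem invStat_eq_sum {n m : ℕ} (σ : Fin n → Fin m) :
    invStat σ = ∑ a, ∑ b, if a < b ∧ σ b < σ a then 1 else 0 := by
  rw [invStat, Finset.card_filter, Fintype.sum_prod_type]

theorem sum_comp_eq_sum_card_mul {α β : Type*} [Fintype α] [Fintype β] [DecidableEq β]
    (τ : α → β) (g : β → ℕ) :
    ∑ x, g (τ x) = ∑ v, (Finset.univ.filter fun x => τ x = v).card * g v := by
  rw [← Finset.sum_fiberwise Finset.univ τ]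
  refine Finset.sum_congr rfl fun v _ => ?_
  rw [← smul_eq_mul, ← Finset.sum_const]
  exact Finset.sum_congr rfl fun x hx => by rw [(Finset.mem_filter.mp hx).2]

section Decomposition

variable {n m k₁ : ℕ} {N : Fin (k₁ + 1) → ℕ}
  (P : Fin k₁ ⊕ (Σ u : Fin (k₁ + 1), Fin (N u)) ≃ Fin n)

theorem card_fiber_eq (σ : Fin n → Fin m) (v : Fin m) :
    (Finset.univ.filter fun a => σ a = v).card =
      (Finset.univ.filter fun i => σ (P (.inl i)) = v).card +
        ∑ u, (Finset.univ.filter fun x => σ (P (.inr ⟨u, x⟩)) = v).card := by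
  simp only [Finset.card_filter]
  rw [← P.sum_comp, Fintype.sum_sum_type, Fintype.sum_sigma]

theorem card_filter_le_val {u : ℕ} :
    (Finset.univ.filter fun i : Fin k₁ => u ≤ i).card = k₁ - u := by
  have h := Fin.card_filter_val_lt (n := k₁) (m := u)
  have h' := Finset.card_filter_add_card_filter_not (s := (Finset.univ : Finset (Fin k₁)))
    (fun i => (i : ℕ) < u)
  simp only [not_lt, Finset.card_univ, Fintype.card_fin] at h'
  omega

/-- Inversions of a sequence whose minimal entries occupy the separators: each remaining entry
is inverted with the separators to its right, with later blocks, and within its own block. -/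
theorem invStat_eq_blocks (hm : 0 < m)
    (h_sep : ∀ u x i, P (.inr ⟨u, x⟩) < P (.inl i) ↔ (u : ℕ) ≤ i)
    (h_lt : ∀ u v x y, u < v → P (.inr ⟨u, x⟩) < P (.inr ⟨v, y⟩))
    (h_same : ∀ u x y, P (.inr ⟨u, x⟩) < P (.inr ⟨u, y⟩) ↔ x < y)
    (σ : Fin n → Fin m) (h₀ : ∀ i, σ (P (.inl i)) = ⟨0, hm⟩)
    (h₁ : ∀ p, σ (P (.inr p)) ≠ ⟨0, hm⟩)
    (r : Fin (k₁ + 1) → Fin m → ℕ)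
    (hr : ∀ u v, (Finset.univ.filter fun x => σ (P (.inr ⟨u, x⟩)) = v).card = r u v) :
    invStat σ =
      (∑ u : Fin (k₁ + 1), ∑ v ∈ Finset.univ.filter (fun v : Fin m => 0 < (v : ℕ)),
        r u v * (k₁ - (u : ℕ) + ∑ i ∈ Finset.univ.filter (fun i => u < i),
          ∑ j ∈ Finset.univ.filter (fun j : Fin m => 0 < (j : ℕ) ∧ j < v), r i j)) +
      ∑ u, invStat fun x => σ (P (.inr ⟨u, x⟩)) := by
  have hr₀ (u) : r u ⟨0, hm⟩ = 0 := by
    rw [← hr, Finset.card_eq_zero, Finset.filter_eq_empty_iff]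
    exact fun x _ => h₁ _
  have hpos (v : Fin m) (hv : v ≠ ⟨0, hm⟩) : 0 < (v : ℕ) := by
    rw [Ne, Fin.ext_iff] at hv
    exact Nat.pos_of_ne_zero hv
  have h_later (i) (v : Fin m) :
      ∑ j ∈ Finset.univ.filter (fun j : Fin m => 0 < (j : ℕ) ∧ j < v), r i j =
        ∑ y, if σ (P (.inr ⟨i, y⟩)) < v then 1 else 0 := by
    rw [sum_comp_eq_sum_card_mul (fun y => σ (P (.inr ⟨i, y⟩))) (fun j => if j < v then 1 else 0),
      Finset.sum_filter]
    refine Finset.sum_congr rfl fun j _ => ?_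
    rw [hr]
    by_cases hj : j = ⟨0, hm⟩
    · simp [hj, hr₀]
    · simp [hpos j hj]
  have h_entry (u x) :
      (∑ b, if P (.inr ⟨u, x⟩) < b ∧ σ b < σ (P (.inr ⟨u, x⟩)) then 1 else 0) =
        (k₁ - (u : ℕ) + ∑ i ∈ Finset.univ.filter (fun i => u < i),
          ∑ y, if σ (P (.inr ⟨i, y⟩)) < σ (P (.inr ⟨u, x⟩)) then 1 else 0) +
        ∑ y, if x < y ∧ σ (P (.inr ⟨u, y⟩)) < σ (P (.inr ⟨u, x⟩)) then 1 else 0 := by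
    have h0lt : (⟨0, hm⟩ : Fin m) < σ (P (.inr ⟨u, x⟩)) := hpos _ (h₁ _)
    rw [← P.sum_comp, Fintype.sum_sum_type, Fintype.sum_sigma]
    simp only [h_sep, h₀, h0lt, and_true]
    rw [← Finset.card_filter, card_filter_le_val, add_assoc, Finset.sum_filter,
      ← Finset.sum_erase_add _ _ (Finset.mem_univ u)]
    simp only [h_same]
    congr 2
    rw [← Finset.sum_erase (a := u) (s := Finset.univ)]
    · refine Finset.sum_congr rfl fun i hi => ?_
      rcases lt_or_gt_of_ne (Finset.ne_of_mem_erase hi) with h | h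
      · simp [h.not_gt, (h_lt _ _ _ _ h).not_gt]
      · simp [h, h_lt _ _ _ _ h]
    · simp
  rw [invStat_eq_sum, ← P.sum_comp, Fintype.sum_sum_type, Fintype.sum_sigma]
  simp only [h_entry]
  have h_first : (∑ i, ∑ b, if P (.inl i) < b ∧ σ b < σ (P (.inl i)) then 1 else 0) = 0 := by
    have h_not (v : Fin m) : ¬v < ⟨0, hm⟩ := Nat.not_lt_zero v
    simp [h₀, h_not]
  rw [h_first, zero_add, ← Finset.sum_add_distrib]
  refine Finset.sum_congr rfl fun u _ => ?_
  rw [Finset.sum_add_distrib, invStat_eq_sum]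
  congr 1
  simp only [h_later]
  rw [sum_comp_eq_sum_card_mul (fun x => σ (P (.inr ⟨u, x⟩))) (fun v => k₁ - (u : ℕ) +
    ∑ i ∈ Finset.univ.filter (fun i => u < i),
      ∑ y, if σ (P (.inr ⟨i, y⟩)) < v then 1 else 0)]
  simp only [hr]
  rw [Finset.sum_filter_of_ne]
  intro v _ hv
  refine hpos v ?_
  rintro rfl
  simp [hr₀] at hv

end Decomposition


/-- the `q`-analog of the generalized Chu Shih-Chieh identity.
`[n; k_1, …, k_m]_q = Σ_E Σ_{(r_{u,v})} q^{Σ_u Σ_{v≥2} f(r_{u,v})}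
  [n_1; 0, r_{1,2}, …, r_{1,m}]_q ⋯ [n_s; 0, r_{s,2}, …, r_{s,m}]_q`, where `E` ranges
over `k_1`-element subsets of `{1, …, n}`, `s = k_1 + 1`, the `n_u` are the block lengths
determined by `E`, the arrays `(r_{u,v})` (for `v ∈ {2, …, m}`) satisfy
`Σ_{v≥2} r_{u,v} = n_u` and `Σ_u r_{u,v} = k_v`, and
`f(r_{u,v}) = r_{u,v} (k_1 − u + 1 + Σ_{i>u} Σ_{2≤j<v} r_{i,j})` (for 1-based `u`;
with 0-based `u` the factor `k_1 − u + 1` reads `k_1 − u`). -/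
theorem stmt13 (m n : ℕ) (hm : 0 < m) (k : Fin m → ℕ) (hk : ∑ i, k i = n) :
    qMultinomial n m k =
      ∑ E ∈ ((Finset.univ : Finset (Fin n)).powersetCard (k ⟨0, hm⟩)).attach,
        ∑ r ∈ (Fintype.piFinset fun u : Fin (k ⟨0, hm⟩ + 1) =>
                Fintype.piFinset fun _ : Fin m =>
                  Finset.Iic (blockLen n (k ⟨0, hm⟩) E.1
                    (Finset.mem_powersetCard.mp E.2).2 u)).filter
            (fun r => (∀ u, r u ⟨0, hm⟩ = 0) ∧
              (∀ u, ∑ v ∈ Finset.univ.filter (fun v : Fin m => 0 < (v : ℕ)), r u v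
                  = blockLen n (k ⟨0, hm⟩) E.1 (Finset.mem_powersetCard.mp E.2).2 u) ∧
              (∀ v : Fin m, 0 < (v : ℕ) → ∑ u, r u v = k v)),
          X ^ (∑ u : Fin (k ⟨0, hm⟩ + 1),
                ∑ v ∈ Finset.univ.filter (fun v : Fin m => 0 < (v : ℕ)),
                  r u v * (k ⟨0, hm⟩ - (u : ℕ) +
                    ∑ i ∈ Finset.univ.filter (fun i => u < i),
                      ∑ j ∈ Finset.univ.filter (fun j : Fin m => 0 < (j : ℕ) ∧ j < v),
                        r i j)) *
            ∏ u : Fin (k ⟨0, hm⟩ + 1),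
              qMultinomial (blockLen n (k ⟨0, hm⟩) E.1
                (Finset.mem_powersetCard.mp E.2).2 u) m (r u) := by
  set z : Fin m := ⟨0, hm⟩
  have hpos (v : Fin m) : 0 < (v : ℕ) ↔ v ≠ z := by
    rw [Ne, Fin.ext_iff]
    exact Nat.pos_iff_ne_zero
  unfold qMultinomial
  rw [← Finset.sum_fiberwise_of_maps_to
    (t := (Finset.univ : Finset (Fin n)).powersetCard (k z))
    (g := fun σ => Finset.univ.filter fun a => σ a = z)
    (fun σ hσ => by simpa using (Finset.mem_filter.mp hσ).2 z), ← Finset.sum_attach]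
  refine Finset.sum_congr rfl fun ⟨E, hE'⟩ _ => ?_
  have hE : E.card = k z := (Finset.mem_powersetCard.mp hE').2
  obtain ⟨P, hP₁, hP₂, h_sep, h_lt, h_same⟩ := exists_blockEquiv n (k z) E hE
  have hsum₀ (f : Fin m → ℕ) (hf : f z = 0) :
      ∑ v ∈ Finset.univ.filter (fun v : Fin m => 0 < (v : ℕ)), f v = ∑ v, f v := by
    refine Finset.sum_filter_of_ne fun v _ hv => (hpos v).mpr ?_
    rintro rfl
    exact hv hf
  have hzeros (σ : Fin n → Fin m) (h : (Finset.univ.filter fun a => σ a = z) = E) :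
      (∀ i, σ (P (.inl i)) = z) ∧ ∀ p, σ (P (.inr p)) ≠ z := by
    subst h
    simpa using And.intro hP₁ hP₂
  have hcount (σ : Fin n → Fin m) (h : ∀ i, σ (P (.inl i)) = z) (v : Fin m) (hv : v ≠ z) :
      (Finset.univ.filter fun a => σ a = v).card =
        ∑ u, (Finset.univ.filter fun x => σ (P (.inr ⟨u, x⟩)) = v).card := by
    rw [card_fiber_eq P]
    simp [h, hv.symm]
  refine Eq.trans (Finset.sum_fiberwise_of_maps_to
    (g := fun σ u v => (Finset.univ.filter fun x => σ (P (.inr ⟨u, x⟩)) = v).card) ?_ _).symm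
    (Finset.sum_congr rfl fun r hr => ?_)
  · intro σ hσ
    simp only [Finset.mem_filter, Finset.mem_univ, true_and] at hσ
    obtain ⟨hk', hσ⟩ := hσ
    obtain ⟨h₀, h₁⟩ := hzeros σ hσ
    simp only [Finset.mem_filter, Fintype.mem_piFinset, Finset.mem_Iic]
    refine ⟨fun u v => (Finset.card_le_univ _).trans (by simp), fun u => by simp [h₁],
      fun u => ?_, fun v hv => ?_⟩
    · rw [hsum₀ _ (by simp [h₁]),
        ← Finset.card_eq_sum_card_fiberwise (fun _ _ => Finset.mem_coe.mpr (Finset.mem_univ _))]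
      simp
    · rw [← hcount σ h₀ v ((hpos v).mp hv), hk']
  simp only [Finset.mem_filter, Fintype.mem_piFinset, Finset.mem_Iic] at hr
  obtain ⟨-, hr₀, -, hrk⟩ := hr
  rw [Finset.prod_univ_sum, Finset.mul_sum]
  refine Finset.sum_nbij' (fun σ u x => σ (P (.inr ⟨u, x⟩)))
    (fun τ a => Sum.elim (fun _ => z) (fun p => τ p.1 p.2) (P.symm a)) ?_ ?_ ?_ ?_ ?_
  · intro σ hσ
    simp only [Finset.mem_filter, Finset.mem_univ, true_and, Fintype.mem_piFinset] at hσ ⊢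
    intro u v
    exact congrFun (congrFun hσ.2 u) v
  · intro τ hτ
    simp only [Finset.mem_filter, Finset.mem_univ, true_and, Fintype.mem_piFinset] at hτ ⊢
    have hτz (u x) : τ u x ≠ z := by
      have := (hτ u z).trans (hr₀ u)
      rw [Finset.card_eq_zero, Finset.filter_eq_empty_iff] at this
      exact this (Finset.mem_univ x)
    have hEτ : (Finset.univ.filter fun a =>
        Sum.elim (fun _ => z) (fun p => τ p.1 p.2) (P.symm a) = z) = E := by
      ext a
      obtain ⟨i | p, rfl⟩ := P.surjective a
      · simpa using hP₁ i
      · simpa [hτz] using hP₂ p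
    refine ⟨⟨fun v => ?_, hEτ⟩, ?_⟩
    · by_cases hv : v = z
      · subst hv
        rw [hEτ, hE]
      · rw [hcount _ (by simp) v hv, ← hrk v ((hpos v).mpr hv)]
        simp [hτ]
    · ext u v
      simpa using hτ u v
  · intro σ hσ
    simp only [Finset.mem_filter, Finset.mem_univ, true_and] at hσ
    ext1 a
    obtain ⟨i | p, rfl⟩ := P.surjective a
    · simp [(hzeros σ hσ.1.2).1]
    · simp
  · intro τ _
    ext1 u
    ext1 x
    simp
  · intro σ hσ
    simp only [Finset.mem_filter, Finset.mem_univ, true_and] at hσ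
    obtain ⟨⟨-, hσ⟩, hσr⟩ := hσ
    obtain ⟨h₀, h₁⟩ := hzeros σ hσ
    rw [invStat_eq_blocks P hm h_sep h_lt h_same σ h₀ h₁ r
      (fun u v => congrFun (congrFun hσr u) v), pow_add, Finset.prod_pow_eq_pow_sum]
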